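/- arXiv:1506.03529 — 5 statements merged into one kernel-verified Lean document; each statement's English description precedes it below -/
import Mathlib

section
/- Let A be a commutative ring and let π ∈ A be an element that is not a zero divisor, such that the quotient ring A/(π) is reduced. Then every idempotent element of the localization A[1/π] of A away from π lies in the image of the canonical map A → A[1/π]. -/
/-- If `A/(π)` is reduced, then `π` divides every element whose square it divides. -/
theorem dvd_of_dvd_sq_of_isReduced_quotient {A : Type*} [CommRing A] {π a : A}
    (hred : IsReduced (A ⧸ Ideal.span ({π} : Set A))) (h : π ∣ a ^ 2) : π ∣ a := by
  rw [← Ideal.mem_span_singleton, ← Ideal.Quotient.eq_zero_iff_mem] at h ⊢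
  rw [map_pow] at h
  exact eq_zero_of_pow_eq_zero h

/-- Let `A` be a commutative ring and `π ∈ A` a non-zero-divisor such that `A/(π)` is
reduced. Then every idempotent of the localization `A[1/π]` lies in the image of the
canonical map `A → A[1/π]`. -/
theorem stmt0 {A : Type*} [CommRing A] (π : A) (hπ : π ∈ nonZeroDivisors A)
    (hred : IsReduced (A ⧸ Ideal.span ({π} : Set A)))
    (e : Localization.Away π) (he : e * e = e) :
    ∃ a : A, algebraMap A (Localization.Away π) a = e := by
  have hinj : Function.Injective (algebraMap A (Localization.Away π)) :=
    IsLocalization.injective _ (Submonoid.powers_le.mpr hπ)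
  obtain ⟨n, a, h⟩ := IsLocalization.Away.surj π e
  induction n generalizing a with
  | zero => exact ⟨a, by simpa using h.symm⟩
  | succ n ih =>
    have hsq : a ^ 2 = π * (π ^ n * a) := hinj <| by
      simp only [map_pow, map_mul, ← h]
      linear_combination (algebraMap A (Localization.Away π) π) ^ (2 * n + 2) * he
    obtain ⟨b, rfl⟩ := dvd_of_dvd_sq_of_isReduced_quotient hred ⟨_, hsq⟩
    refine ih b ((IsLocalization.Away.algebraMap_isUnit (S := Localization.Away π) π).mul_left_cancel ?_)
    rw [← map_mul, ← h]
    ring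
end

section
/- Let A be a commutative ring and let π ∈ A be an element that is not a zero divisor, such that the quotient ring A/(π) is reduced. If the only idempotent elements of A are 0 and 1, then the only idempotent elements of the localization A[1/π] are 0 and 1. -/
/-- If `A/(π)` is reduced, then `π ∣ a ^ 2` implies `π ∣ a`. -/
theorem dvd_of_dvd_mul_self_of_isReduced_quotient {A : Type*} [CommRing A] {π a : A}
    (hred : IsReduced (A ⧸ Ideal.span ({π} : Set A))) (h : π ∣ a * a) : π ∣ a := by
  rw [← Ideal.mem_span_singleton, ← Ideal.Quotient.eq_zero_iff_mem] at h ⊢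
  rw [map_mul, ← sq] at h
  exact pow_eq_zero_iff two_ne_zero |>.mp h

/-- If `π` is a non-zero-divisor and `A/(π)` is reduced, a solution of `a² = πⁿ a` is
`πⁿ` times an idempotent. -/
theorem exists_idempotent_of_mul_self_eq_pow_mul {A : Type*} [CommRing A] {π : A}
    (hπ : π ∈ nonZeroDivisors A) (hred : IsReduced (A ⧸ Ideal.span ({π} : Set A)))
    (n : ℕ) (a : A) (ha : a * a = π ^ n * a) : ∃ b : A, b * b = b ∧ a = π ^ n * b := by
  induction n generalizing a with
  | zero => exact ⟨a, by simpa using ha, by simp⟩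
  | succ n ih =>
    obtain ⟨c, rfl⟩ := dvd_of_dvd_mul_self_of_isReduced_quotient hred
      (a := a) ⟨π ^ n * a, by rw [ha]; ring⟩
    have hc : c * c = π ^ n * c := by
      have h : (π * π) * (c * c) = (π * π) * (π ^ n * c) := by linear_combination ha
      exact (mul_cancel_left_mem_nonZeroDivisors (mul_mem hπ hπ)).mp h
    obtain ⟨b, hb, rfl⟩ := ih c hc
    exact ⟨b, hb, by ring⟩

/-- Let `A` be a commutative ring and `π ∈ A` a non-zero-divisor such that `A/(π)` is
reduced. If the only idempotents of `A` are `0` and `1`, then the only idempotents of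
the localization `A[1/π]` are `0` and `1`. -/
theorem stmt1 {A : Type*} [CommRing A] (π : A) (hπ : π ∈ nonZeroDivisors A)
    (hred : IsReduced (A ⧸ Ideal.span ({π} : Set A)))
    (hA : ∀ a : A, a * a = a → a = 0 ∨ a = 1)
    (e : Localization.Away π) (he : e * e = e) :
    e = 0 ∨ e = 1 := by
  obtain ⟨⟨a, s, n, rfl⟩, hs⟩ := IsLocalization.surj (Submonoid.powers π) e
  replace hs : e * algebraMap A _ (π ^ n) = algebraMap A _ a := hs
  have hinj : Function.Injective (algebraMap A (Localization.Away π)) :=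
    IsLocalization.injective _ (Submonoid.powers_le.mpr hπ)
  have ha : a * a = π ^ n * a := hinj <| by
    rw [map_mul, map_mul, ← hs]
    linear_combination (algebraMap A (Localization.Away π) (π ^ n)) ^ 2 * he
  obtain ⟨b, hb, rfl⟩ := exists_idempotent_of_mul_self_eq_pow_mul hπ hred n a ha
  have hu : IsUnit (algebraMap A (Localization.Away π) (π ^ n)) :=
    IsLocalization.map_units _ (⟨π ^ n, n, rfl⟩ : Submonoid.powers π)
  have heb : e = algebraMap A _ b := hu.mul_right_cancel <| by rw [hs, map_mul, mul_comm]
  rcases hA b hb with rfl | rfl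
  · exact Or.inl (heb.trans (map_zero _))
  · exact Or.inr (heb.trans (map_one _))
end

section
/- Let k be a field of characteristic different from 2 and let g, ḡ ∈ k[x,y] be polynomials such that g(0,0) = 0, (∂g/∂x)(0,0) = 0, and the coefficient of x² in the univariate polynomial g(x,0) is nonzero (so the curve g = 0 passes through the origin and is simply tangent to the x-axis there). Let k[ε], ε² = 0, be the dual numbers, and let G(X) = g(X,0) + ε·ḡ(X,0) ∈ k[ε][X]. Then there exists x₀ ∈ k such that G(ε·x₀) = 0 and G′(ε·x₀) = 0 if and only if ḡ(0,0) = 0. -/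
open Polynomial

/-- A polynomial over `k` evaluated at a multiple of `ε` is its first-order expansion. -/
lemma eval_smul_eps_map {k : Type*} [CommRing k] (x : k) (p : k[X]) :
    (p.map (algebraMap k (DualNumber k))).eval (x • DualNumber.eps)
      = algebraMap k (DualNumber k) (p.coeff 0) + (x * p.coeff 1) • DualNumber.eps := by
  have h := Polynomial.aeval_add_of_sq_eq_zero p (0 : DualNumber k) (x • DualNumber.eps)
    (by simp [sq])
  rw [zero_add] at h
  rw [Polynomial.eval_map_algebraMap, h, ← Polynomial.coeff_zero_eq_aeval_zero',
    ← Polynomial.coeff_zero_eq_aeval_zero', Polynomial.coeff_derivative]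
  simp [Algebra.smul_def, mul_comm, mul_left_comm]

/-- The constant coefficient of the restriction to the first axis is the value at the origin. -/
lemma coeff_zero_aeval_X_zero {k : Type*} [CommRing k] (p : MvPolynomial (Fin 2) k) :
    (MvPolynomial.aeval ![X, 0] p : k[X]).coeff 0 = MvPolynomial.eval 0 p := by
  induction p using MvPolynomial.induction_on with
  | C a => simp
  | add p q hp hq => simp [hp, hq]
  | mul_X p i hp => fin_cases i <;> simp [mul_coeff_zero]

/-- The linear coefficient of the restriction to the first axis is the first partial derivative
at the origin. -/
lemma coeff_one_aeval_X_zero {k : Type*} [CommRing k] (p : MvPolynomial (Fin 2) k) :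
    (MvPolynomial.aeval ![X, 0] p : k[X]).coeff 1
      = MvPolynomial.eval 0 (MvPolynomial.pderiv 0 p) := by
  induction p using MvPolynomial.induction_on with
  | C a => simp
  | add p q hp hq => simp [hp, hq]
  | mul_X p i hp =>
    fin_cases i <;> simp [MvPolynomial.pderiv_X, coeff_zero_aeval_X_zero]

/-- Let `k` be a field of characteristic `≠ 2` and `g, ḡ ∈ k[x,y]` with `g(0,0) = 0`,
`∂g/∂x(0,0) = 0` and the coefficient of `x²` in `g(x,0)` nonzero (so `g = 0` is simply
tangent to the `x`-axis at the origin). Let `G(X) = g(X,0) + ε·ḡ(X,0) ∈ k[ε][X]` over the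
dual numbers. Then there exists `x₀ ∈ k` with `G(ε·x₀) = 0` and `G′(ε·x₀) = 0` if and
only if `ḡ(0,0) = 0`. -/
theorem stmt2 {k : Type*} [Field k] (hchar : (2 : k) ≠ 0)
    (g gbar : MvPolynomial (Fin 2) k)
    (hg00 : MvPolynomial.eval (0 : Fin 2 → k) g = 0)
    (hgx : MvPolynomial.eval (0 : Fin 2 → k) (MvPolynomial.pderiv 0 g) = 0)
    (hg2 : (MvPolynomial.aeval ![Polynomial.X, 0] g : Polynomial k).coeff 2 ≠ 0) :
    (∃ x₀ : k,
      Polynomial.eval (x₀ • DualNumber.eps)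
        (((MvPolynomial.aeval ![Polynomial.X, 0] g : Polynomial k).map
            (algebraMap k (DualNumber k)))
          + Polynomial.C DualNumber.eps *
            ((MvPolynomial.aeval ![Polynomial.X, 0] gbar : Polynomial k).map
              (algebraMap k (DualNumber k)))) = 0
      ∧ Polynomial.eval (x₀ • DualNumber.eps)
          (Polynomial.derivative
            (((MvPolynomial.aeval ![Polynomial.X, 0] g : Polynomial k).map
                (algebraMap k (DualNumber k)))
              + Polynomial.C DualNumber.eps *
                ((MvPolynomial.aeval ![Polynomial.X, 0] gbar : Polynomial k).map
                  (algebraMap k (DualNumber k))))) = 0)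
    ↔ MvPolynomial.eval (0 : Fin 2 → k) gbar = 0 := by
  have h0 := (coeff_zero_aeval_X_zero g).trans hg00
  have h1 := (coeff_one_aeval_X_zero g).trans hgx
  rw [← coeff_zero_aeval_X_zero gbar]
  generalize (MvPolynomial.aeval ![Polynomial.X, 0] g : Polynomial k) = p at *
  generalize (MvPolynomial.aeval ![Polynomial.X, 0] gbar : Polynomial k) = q at *
  simp only [derivative_add, derivative_mul, derivative_C, zero_mul, zero_add, derivative_map,
    eval_add, eval_mul, eval_C, eval_smul_eps_map, coeff_derivative, h0, h1]
  suffices h : q.coeff 0 = 0 → ∃ x, x * (p.coeff 2 * (1 + 1)) + q.coeff 1 = 0 by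
    simpa [TrivSqZeroExt.ext_iff, TrivSqZeroExt.algebraMap_eq_inl] using h
  refine fun _ ↦ ⟨-q.coeff 1 / (2 * p.coeff 2), ?_⟩
  field_simp
  ring
end

section
/- Let R be a commutative ring and r ∈ R, and let Q ∈ R[x,y,z,t] be the Craighero–Gattazzo quintic polynomial. Then Q and all four of its first-order partial derivatives ∂Q/∂x, ∂Q/∂y, ∂Q/∂z, ∂Q/∂t vanish at each of the four points (1,0,0,0), (0,1,0,0), (0,0,1,0), (0,0,0,1). In particular, the quintic surface Q = 0 in ℙ³ is singular at the four coordinate points. -/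
open MvPolynomial

/-- The Craighero–Gattazzo quintic polynomial in `R[x,y,z,t]`, with parameter `r ∈ R`.
Variables: `X 0 = x`, `X 1 = y`, `X 2 = z`, `X 3 = t`. -/
noncomputable def CGquintic (R : Type*) [CommRing R] (r : R) : MvPolynomial (Fin 4) R :=
  let a : R := 7 * r ^ 2
  let b : R := -2 * r ^ 2 + 13 * r + 18
  let c : R := 73 * r ^ 2 + 75 * r + 92
  let e : R := -r ^ 2 + 24 * r + 9
  let f : R := 181 * r ^ 2 + 241 * r + 163
  let m : R := 3 * r ^ 2 + 5 * r + 1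
  let x : MvPolynomial (Fin 4) R := X 0
  let y : MvPolynomial (Fin 4) R := X 1
  let z : MvPolynomial (Fin 4) R := X 2
  let t : MvPolynomial (Fin 4) R := X 3
  C (a ^ 2) * (x ^ 2 * y ^ 3 + x ^ 3 * t ^ 2 + y ^ 2 * z ^ 3 + z ^ 2 * t ^ 3) +
  C (m ^ 2) * (x ^ 3 * z ^ 2 + x ^ 2 * z ^ 3 + y ^ 3 * t ^ 2 + y ^ 2 * t ^ 3) +
  C (2 * a * m) * (x * y * z ^ 3 + x * y ^ 3 * t + x ^ 3 * z * t + y * z * t ^ 3) +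
  C (14 * m) * (x ^ 3 * y * z + y ^ 3 * z * t + x * z ^ 3 * t + x * y * t ^ 3) +
  C (7 * b) * (x ^ 2 * y ^ 2 * z + y ^ 2 * z ^ 2 * t + x ^ 2 * y * t ^ 2 + x * z ^ 2 * t ^ 2) +
  C (14 * a) * (x * y ^ 3 * z + x ^ 3 * y * t + y * z ^ 3 * t + x * z * t ^ 3) +
  C c * (x ^ 2 * y * z ^ 2 + x ^ 2 * z ^ 2 * t + x * y ^ 2 * t ^ 2 + y ^ 2 * z * t ^ 2) +
  C (7 * e) * (x * y ^ 2 * z ^ 2 + x ^ 2 * y ^ 2 * t + x ^ 2 * z * t ^ 2 + y * z ^ 2 * t ^ 2) +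
  C f * (x ^ 2 * y * z * t + x * y ^ 2 * z * t + x * y * z ^ 2 * t + x * y * z * t ^ 2) +
  C 49 * (x ^ 3 * y ^ 2 + y ^ 3 * z ^ 2 + z ^ 3 * t ^ 2 + x ^ 2 * t ^ 3)

/-- The Craighero–Gattazzo quintic and all four of its first-order partial derivatives
vanish at each of the four coordinate points `(1,0,0,0), (0,1,0,0), (0,0,1,0),
(0,0,0,1)`; i.e. the quintic surface is singular at the four coordinate points. -/
theorem stmt8 (R : Type*) [CommRing R] (r : R) (i : Fin 4) :
    MvPolynomial.eval (fun j : Fin 4 => if j = i then (1 : R) else 0) (CGquintic R r) = 0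
      ∧ ∀ j : Fin 4,
        MvPolynomial.eval (fun j' : Fin 4 => if j' = i then (1 : R) else 0)
          (MvPolynomial.pderiv j (CGquintic R r)) = 0 := by
  constructor
  · fin_cases i <;> simp [CGquintic]
  · intro j
    simp only [CGquintic, map_add, Derivation.leibniz, Derivation.leibniz_pow,
      smul_eq_mul, nsmul_eq_mul, eval_mul, eval_pow, eval_C, eval_X]
    fin_cases i <;> simp
end

section
/- In the polynomial ring (ℤ/7ℤ)[x,y,z,t], there exists a nonzero scalar c ∈ ℤ/7ℤ such that f₃² − 4·f₁·f₅ − c·g₁·g₂ lies in the ideal generated by xz + yt. In other words, on the quadric xz + yt = 0 over a field of characteristic 7, the discriminant curve f₃² − 4 f₁ f₅ = 0 is the union of the two cubic section curves B₁ = (g₁ = 0) and B₂ = (g₂ = 0). -/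
open MvPolynomial

namespace CGforms

local notation "x" => (X 0 : MvPolynomial (Fin 4) (ZMod 7))
local notation "y" => (X 1 : MvPolynomial (Fin 4) (ZMod 7))
local notation "z" => (X 2 : MvPolynomial (Fin 4) (ZMod 7))
local notation "t" => (X 3 : MvPolynomial (Fin 4) (ZMod 7))

/-- `f₁ = x + y + z + t`. -/
noncomputable def f₁ : MvPolynomial (Fin 4) (ZMod 7) := x + y + z + t

/-- `f₂ = xz + yt`. -/
noncomputable def f₂ : MvPolynomial (Fin 4) (ZMod 7) := x * z + y * t

/-- The cubic form `f₃` from the 7-adic expansion of the Craighero–Gattazzo quintic. -/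
noncomputable def f₃ : MvPolynomial (Fin 4) (ZMod 7) :=
  2 * (x ^ 2 * y + y ^ 2 * z + z ^ 2 * t + x * t ^ 2)
    + x ^ 2 * z + x * z ^ 2 + y ^ 2 * t + y * t ^ 2
    - 3 * (x * y ^ 2 + y * z ^ 2 + x ^ 2 * t + z * t ^ 2
        + x * y * z + x * y * t + x * z * t + y * z * t)

/-- The quintic form `f₅` from the 7-adic expansion of the Craighero–Gattazzo quintic. -/
noncomputable def f₅ : MvPolynomial (Fin 4) (ZMod 7) :=
  x ^ 3 * y ^ 2 + x ^ 3 * z ^ 2 + y ^ 3 * z ^ 2 + x ^ 2 * z ^ 3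
    + y ^ 3 * t ^ 2 + z ^ 3 * t ^ 2 + x ^ 2 * t ^ 3 + y ^ 2 * t ^ 3
    + x ^ 3 * y * z + y ^ 3 * z * t + x * z ^ 3 * t + x * y * t ^ 3
    - x * y ^ 2 * z ^ 2 - x ^ 2 * y ^ 2 * t - x ^ 2 * z * t ^ 2 - y * z ^ 2 * t ^ 2
    - x ^ 2 * y * z * t - x * y ^ 2 * z * t - x * y * z ^ 2 * t - x * y * z * t ^ 2
    - 3 * x ^ 2 * y ^ 3 - 3 * y ^ 2 * z ^ 3 - 3 * x ^ 3 * t ^ 2 - 3 * z ^ 2 * t ^ 3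
    - 2 * x ^ 2 * y ^ 2 * z - 2 * x ^ 2 * y * z ^ 2 - 2 * x ^ 2 * z ^ 2 * t
    - 2 * y ^ 2 * z ^ 2 * t - 2 * x ^ 2 * y * t ^ 2 - 2 * x * y ^ 2 * t ^ 2
    - 2 * y ^ 2 * z * t ^ 2 - 2 * x * z ^ 2 * t ^ 2
    - 3 * x * y ^ 3 * z - 3 * x ^ 3 * y * t - 3 * y * z ^ 3 * t - 3 * x * z * t ^ 3

/-- The equation `g₁` of the branch curve `B₁`. -/
noncomputable def g₁ : MvPolynomial (Fin 4) (ZMod 7) :=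
  x * y ^ 2 + 3 * x ^ 2 * z - 3 * y ^ 2 * z + 3 * x * z ^ 2 - 3 * x * t ^ 2 + z * t ^ 2

/-- The equation `g₂` of the branch curve `B₂`. -/
noncomputable def g₂ : MvPolynomial (Fin 4) (ZMod 7) :=
  y * z ^ 2 + 3 * y ^ 2 * t - 3 * z ^ 2 * t + 3 * y * t ^ 2 - 3 * x ^ 2 * y + x ^ 2 * t

end CGforms

open CGforms in
/-- On the quadric `xz + yt = 0` in characteristic `7`, the discriminant
`f₃² − 4f₁f₅` is a nonzero scalar multiple of `g₁·g₂`: there is a nonzero `c ∈ ℤ/7ℤ`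
with `f₃² − 4f₁f₅ − c·g₁g₂` in the ideal generated by `xz + yt`. -/
theorem stmt11 :
    ∃ c : ZMod 7, c ≠ 0 ∧
      f₃ ^ 2 - 4 * f₁ * f₅ - C c * (g₁ * g₂)
        ∈ Ideal.span ({f₂} : Set (MvPolynomial (Fin 4) (ZMod 7))) := by
  refine ⟨6, by decide, Ideal.mem_span_singleton'.mpr ⟨
    -2 * X 0 ^ 3 * X 1 - 3 * X 0 ^ 3 * X 2 - 3 * X 0 ^ 3 * X 3 + 3 * X 0 ^ 2 * X 1 ^ 2
      + 3 * X 0 ^ 2 * X 1 * X 2 + X 0 ^ 2 * X 1 * X 3 + X 0 ^ 2 * X 2 ^ 2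
      + 2 * X 0 ^ 2 * X 2 * X 3 + 3 * X 0 ^ 2 * X 3 ^ 2 - 3 * X 0 * X 1 ^ 3
      + X 0 * X 1 ^ 2 * X 2 + 2 * X 0 * X 1 ^ 2 * X 3 + 2 * X 0 * X 1 * X 2 ^ 2
      - X 0 * X 1 * X 2 * X 3 + 3 * X 0 * X 1 * X 3 ^ 2 - 3 * X 0 * X 2 ^ 3
      + 3 * X 0 * X 2 ^ 2 * X 3 + X 0 * X 2 * X 3 ^ 2 - 2 * X 0 * X 3 ^ 3
      - 2 * X 1 ^ 3 * X 2 - 3 * X 1 ^ 3 * X 3 + 3 * X 1 ^ 2 * X 2 ^ 2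
      + 3 * X 1 ^ 2 * X 2 * X 3 + X 1 ^ 2 * X 3 ^ 2 - 3 * X 1 * X 2 ^ 3
      + X 1 * X 2 ^ 2 * X 3 + 2 * X 1 * X 2 * X 3 ^ 2 - 3 * X 1 * X 3 ^ 3
      - 2 * X 2 ^ 3 * X 3 + 3 * X 2 ^ 2 * X 3 ^ 2 - 3 * X 2 * X 3 ^ 3, ?_⟩⟩
  simp only [f₁, f₂, f₃, f₅, g₁, g₂, map_ofNat]
  grind
end
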